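/- Let a > 0 and let h : ℝ³ → ℝ be bounded and uniformly continuous. Then sup over x ∈ ℝ³ of | ∫_{ℝ³} g_{a,ε}(x,y) h(y) dy − h(x)/a² | tends to 0 as ε → 0⁺, where g_{a,ε}(x,y) = exp(−(a/ε)‖x−y‖)/(4π ε² ‖x−y‖). -/

import Mathlib

open MeasureTheory Set Filter Topology

lemma integral_pow_mul_exp_neg_mul_Ioi (n : ℕ) {b : ℝ} (hb : 0 < b) :
    ∫ t in Ioi (0 : ℝ), t ^ n * Real.exp (-b * t) = n.factorial / b ^ (n + 1) := by
  have key := Real.integral_rpow_mul_exp_neg_mul_Ioi (a := n + 1) (r := b) (by positivity) hb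
  rw [Real.Gamma_nat_eq_factorial] at key
  simp only [add_sub_cancel_right, Real.rpow_natCast, neg_mul] at key ⊢
  rw [key, show (n : ℝ) + 1 = ((n + 1 : ℕ) : ℝ) by push_cast; rfl, Real.rpow_natCast, one_div, inv_pow]
  ring

lemma integrableOn_pow_mul_exp_neg_mul_Ioi (n : ℕ) {b : ℝ} (hb : 0 < b) :
    IntegrableOn (fun t : ℝ => t ^ n * Real.exp (-b * t)) (Ioi 0) := by
  refine not_imp_comm.1 integral_undef ?_
  rw [integral_pow_mul_exp_neg_mul_Ioi n hb]
  have := n.factorial_pos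
  positivity

lemma integrable_fun_norm_euclideanSpace_fin_three {f : ℝ → ℝ} :
    Integrable (fun z : EuclideanSpace ℝ (Fin 3) => f ‖z‖) ↔
      IntegrableOn (fun t : ℝ => t ^ 2 * f t) (Ioi 0) := by
  simpa using integrable_fun_norm_addHaar (volume : Measure (EuclideanSpace ℝ (Fin 3))) (f := f)

lemma integral_fun_norm_euclideanSpace_fin_three (f : ℝ → ℝ) :
    ∫ z : EuclideanSpace ℝ (Fin 3), f ‖z‖ =
      4 * Real.pi * ∫ t in Ioi (0 : ℝ), t ^ 2 * f t := by
  have hball : (volume : Measure (EuclideanSpace ℝ (Fin 3))).real (Metric.ball 0 1) =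
      Real.pi * 4 / 3 := by
    rw [Measure.real, EuclideanSpace.volume_ball_fin_three]
    have : 0 ≤ Real.pi * 4 / 3 := by positivity
    simp [this]
  rw [integral_fun_norm_addHaar, hball]
  simp
  ring

/-- The radial profile of the Green's function of `-ε²Δ + a²` in `ℝ³`. -/
noncomputable def greenProfile (a ε r : ℝ) : ℝ :=
  Real.exp (-(a / ε) * r) / (4 * Real.pi * ε ^ 2 * r)

section greenProfile

variable {a ε : ℝ}

lemma greenProfile_nonneg {r : ℝ} (hr : 0 ≤ r) : 0 ≤ greenProfile a ε r := by
  unfold greenProfile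
  positivity

lemma sq_mul_greenProfile_mul_pow (hε : 0 < ε) (n : ℕ) (r : ℝ) :
    r ^ 2 * (greenProfile a ε r * r ^ n) =
      (4 * Real.pi * ε ^ 2)⁻¹ * (r ^ (n + 1) * Real.exp (-(a / ε) * r)) := by
  unfold greenProfile
  field_simp
  ring

lemma integrable_greenProfile_mul_pow (ha : 0 < a) (hε : 0 < ε) (n : ℕ) :
    Integrable fun z : EuclideanSpace ℝ (Fin 3) => greenProfile a ε ‖z‖ * ‖z‖ ^ n := by
  refine (integrable_fun_norm_euclideanSpace_fin_three
    (f := fun r => greenProfile a ε r * r ^ n)).2 ?_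
  refine IntegrableOn.congr_fun ?_
    (fun r _ => (sq_mul_greenProfile_mul_pow hε n r).symm) measurableSet_Ioi
  exact (integrableOn_pow_mul_exp_neg_mul_Ioi (n + 1) (div_pos ha hε)).const_mul _

lemma integral_greenProfile_mul_pow (ha : 0 < a) (hε : 0 < ε) (n : ℕ) :
    ∫ z : EuclideanSpace ℝ (Fin 3), greenProfile a ε ‖z‖ * ‖z‖ ^ n =
      (n + 1).factorial * ε ^ n / a ^ (n + 2) := by
  rw [integral_fun_norm_euclideanSpace_fin_three (fun r => greenProfile a ε r * r ^ n),
    setIntegral_congr_fun measurableSet_Ioi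
      (fun r _ => sq_mul_greenProfile_mul_pow hε n r),
    integral_const_mul, integral_pow_mul_exp_neg_mul_Ioi _ (div_pos ha hε), div_pow]
  field_simp
  ring

end greenProfile

/-- A bounded uniformly continuous function has, up to any fixed error, a linear modulus of
continuity. -/
lemma UniformContinuous.exists_abs_sub_le_add_mul_dist {X : Type*} [PseudoMetricSpace X]
    {h : X → ℝ} (hunif : UniformContinuous h) (hbdd : ∃ C : ℝ, ∀ x, |h x| ≤ C) {η : ℝ}
    (hη : 0 < η) : ∃ M : ℝ, 0 ≤ M ∧ ∀ x y, |h y - h x| ≤ η + M * dist x y := by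
  obtain ⟨C, hC⟩ := hbdd
  obtain ⟨δ, hδ, hδη⟩ := Metric.uniformContinuous_iff.1 hunif η hη
  refine ⟨2 * |C| / δ, by positivity, fun x y => ?_⟩
  rcases lt_or_ge (dist x y) δ with hxy | hxy
  · have h₁ := hδη hxy
    rw [dist_comm, Real.dist_eq] at h₁
    have : 0 ≤ 2 * |C| / δ * dist x y := by positivity
    linarith
  · have h₁ : 2 * |C| ≤ 2 * |C| / δ * dist x y := by
      rw [div_mul_eq_mul_div, le_div_iff₀ hδ]
      gcongr
    have h₂ := abs_sub (h y) (h x)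
    linarith [hC x, hC y, le_abs_self C]

lemma abs_integral_greenProfile_mul_sub_le {a ε η M : ℝ} (ha : 0 < a) (hε : 0 < ε)
    {h : EuclideanSpace ℝ (Fin 3) → ℝ} (hbdd : ∃ C : ℝ, ∀ x, |h x| ≤ C) (hcont : Continuous h)
    (x : EuclideanSpace ℝ (Fin 3)) (hM : ∀ y, |h y - h x| ≤ η + M * ‖x - y‖) :
    |(∫ y, greenProfile a ε ‖x - y‖ * h y) - h x / a ^ 2| ≤
      η / a ^ 2 + M * (2 * ε / a ^ 3) := by
  obtain ⟨C, hC⟩ := hbdd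
  have hint₀ : Integrable fun y => greenProfile a ε ‖x - y‖ := by
    simpa using (integrable_greenProfile_mul_pow ha hε 0).comp_sub_left x
  have hint₁ : Integrable fun y => greenProfile a ε ‖x - y‖ * ‖x - y‖ := by
    simpa using (integrable_greenProfile_mul_pow ha hε 1).comp_sub_left x
  have hval₀ : ∫ y, greenProfile a ε ‖x - y‖ = 1 / a ^ 2 := by
    rw [integral_sub_left_eq_self (fun z => greenProfile a ε ‖z‖) volume x]
    simpa using integral_greenProfile_mul_pow ha hε 0
  have hval₁ : ∫ y, greenProfile a ε ‖x - y‖ * ‖x - y‖ = 2 * ε / a ^ 3 := by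
    rw [integral_sub_left_eq_self (fun z => greenProfile a ε ‖z‖ * ‖z‖) volume x]
    simpa using integral_greenProfile_mul_pow ha hε 1
  have hint : Integrable fun y => greenProfile a ε ‖x - y‖ * h y :=
    hint₀.mul_bdd hcont.aestronglyMeasurable (ae_of_all _ hC)
  have hdiff : (∫ y, greenProfile a ε ‖x - y‖ * h y) - h x / a ^ 2 =
      ∫ y, greenProfile a ε ‖x - y‖ * (h y - h x) := by
    simp_rw [mul_sub]
    rw [integral_sub hint (hint₀.mul_const _), integral_mul_const, hval₀]
    ring
  calc |(∫ y, greenProfile a ε ‖x - y‖ * h y) - h x / a ^ 2|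
      = ‖∫ y, greenProfile a ε ‖x - y‖ * (h y - h x)‖ := by rw [hdiff, Real.norm_eq_abs]
    _ ≤ ∫ y, (greenProfile a ε ‖x - y‖ * η + M * (greenProfile a ε ‖x - y‖ * ‖x - y‖)) := by
        refine norm_integral_le_of_norm_le ((hint₀.mul_const η).add (hint₁.const_mul M))
          (ae_of_all _ fun y => ?_)
        have hk := greenProfile_nonneg (a := a) (ε := ε) (norm_nonneg (x - y))
        rw [norm_mul, Real.norm_eq_abs, Real.norm_eq_abs, abs_of_nonneg hk]
        linarith [mul_le_mul_of_nonneg_left (hM y) hk]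
    _ = η / a ^ 2 + M * (2 * ε / a ^ 3) := by
        rw [integral_add (hint₀.mul_const η) (hint₁.const_mul M), integral_mul_const,
          integral_const_mul, hval₀, hval₁]
        ring

/-- For `h : ℝ³ → ℝ` bounded and uniformly continuous,
`sup_x |∫ g_{a,ε}(x,y) h(y) dy - h(x)/a²| → 0` as `ε → 0⁺`. -/
theorem green_convolution_uniform_convergence (a : ℝ) (ha : 0 < a)
    (h : EuclideanSpace ℝ (Fin 3) → ℝ)
    (hbdd : ∃ C : ℝ, ∀ x, |h x| ≤ C) (hunif : UniformContinuous h) :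
    Filter.Tendsto
      (fun ε : ℝ =>
        ⨆ x : EuclideanSpace ℝ (Fin 3),
          |(∫ y : EuclideanSpace ℝ (Fin 3),
              Real.exp (-(a / ε) * ‖x - y‖) / (4 * Real.pi * ε ^ 2 * ‖x - y‖) * h y) -
            h x / a ^ 2|)
      (nhdsWithin 0 (Set.Ioi 0)) (nhds 0) := by
  refine tendsto_order.2 ⟨fun l hl => Eventually.of_forall fun ε =>
    hl.trans_le (Real.iSup_nonneg fun x => abs_nonneg _), fun e he => ?_⟩
  obtain ⟨M, hM₀, hM⟩ := hunif.exists_abs_sub_le_add_mul_dist hbdd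
    (η := e / 2 * a ^ 2) (by positivity)
  have hlim : Tendsto (fun ε : ℝ => e / 2 * a ^ 2 / a ^ 2 + M * (2 * ε / a ^ 3))
      (𝓝[>] 0) (𝓝 (e / 2)) := by
    refine (Continuous.tendsto' (by fun_prop) 0 _ ?_).mono_left nhdsWithin_le_nhds
    field_simp
    simp
  filter_upwards [self_mem_nhdsWithin, hlim.eventually_lt_const (half_lt_self he)] with ε hε hlt
  exact (ciSup_le fun x => abs_integral_greenProfile_mul_sub_le ha hε hbdd hunif.continuous x
    fun y => dist_eq_norm x y ▸ hM x y).trans_lt hlt
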